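/- Let t be the Tribonacci word and, for i ≥ 1, let M_i = Σ_{j=1}^{i} F_{4j} = F_4 + F_8 + ⋯ + F_{4i}. Then for every i ≥ 3, P^rel_t(M_i) = { (0,0,0), (0,−1,1), (1,−1,0), (1,0,−1), (0,1,−1), (−1,0,1) } (vectors in ℤ^3 indexed by the letters 0, 1, 2), and consequently AC_t(M_i) = 6; in particular, the abelian complexity of the Tribonacci word attains the value 6 infinitely many times. -/

import Mathlib

/-- The prefix of length `n` of the infinite word `u`. -/
def pref (u : ℕ → ℕ) (n : ℕ) : List ℕ := (List.range n).map u

/-- `w` is a factor of the infinite word `u`. -/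
def IsFactor (u : ℕ → ℕ) (w : List ℕ) : Prop :=
  ∃ i : ℕ, w = (List.range w.length).map (fun j => u (i + j))

/-- The Parikh vector of `w`, viewed as a word over `{0, …, m-1}`. -/
def parikh (m : ℕ) (w : List ℕ) : Fin m → ℤ := fun ℓ => (w.count (ℓ : ℕ) : ℤ)

/-- The set of relative Parikh vectors of factors of `u` of length `n`. -/
def relParikhSet (m : ℕ) (u : ℕ → ℕ) (n : ℕ) : Set (Fin m → ℤ) :=
  { v | ∃ w : List ℕ, IsFactor u w ∧ w.length = n ∧ v = parikh m w - parikh m (pref u n) }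

/-- The extension of a substitution `φ` to finite words. -/
def substW (φ : ℕ → List ℕ) (w : List ℕ) : List ℕ := w.flatMap φ

/-- The `k`-th iterate of the substitution `φ`, applied to the word `w`. -/
def iterW (φ : ℕ → List ℕ) (k : ℕ) (w : List ℕ) : List ℕ := (substW φ)^[k] w

/-- The Tribonacci substitution: 0 ↦ 01, 1 ↦ 02, 2 ↦ 0. -/
def tribo : ℕ → List ℕ
  | 0 => [0, 1]
  | 1 => [0, 2]
  | _ => [0]

/-- `F k = |φ^k(0)|` for the Tribonacci substitution. -/
def triboF (k : ℕ) : ℕ := (iterW tribo k [0]).length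

/-- The fourth power of the Tribonacci substitution, on words. -/
def tribo4 (w : List ℕ) : List ℕ := iterW tribo 4 w

/-- The numbers of occurrences of the letters `0`, `1`, `2` in a word. -/
def letterCounts (w : List ℕ) : ℤ × ℤ × ℤ := (w.count 0, w.count 1, w.count 2)

/-- The sum of the coordinates. -/
def coordSum (v : ℤ × ℤ × ℤ) : ℤ := v.1 + v.2.1 + v.2.2

/-- The incidence matrix of `tribo4`. -/
def incidence4 (v : ℤ × ℤ × ℤ) : ℤ × ℤ × ℤ :=
  (7 * v.1 + 6 * v.2.1 + 4 * v.2.2, 4 * v.1 + 3 * v.2.1 + 2 * v.2.2,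
    2 * v.1 + 2 * v.2.1 + v.2.2)

/-- The image of a letter under `tribo4`, followed by the two letters which begin every image. -/
def block (a : ℕ) : List ℕ := tribo4 [a] ++ [0, 1]

/-- A discrepancy vector together with the letters at the two ends of the window. -/
abbrev WindowState := (ℤ × ℤ × ℤ) × ℕ × ℕ

/-- The states of the windows of length at most two. -/
def initialStates : List WindowState :=
  [0, 1, 2].flatMap fun a =>
    (List.range (tribo4 [a]).length).flatMap fun r : ℕ =>
      [0, 1, 2].map fun j =>
        (letterCounts ((block a).take (r + j)) - letterCounts ((block a).take r),
          (block a).getD r 0, (block a).getD (r + j) 0)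

/-- The state of a window of the image under `tribo4` whose ends lie at offsets `r` and `k` in the
images of the letters at the ends of the original window. -/
def nextState (s : WindowState) (r k : ℕ) : WindowState :=
  (incidence4 (s.1 - (1, 0, 0)) + letterCounts ((block s.2.2).take k)
      - letterCounts ((block s.2.1).take r),
    (block s.2.1).getD r 0, (block s.2.2).getD k 0)

/-- The states of the windows of admissible length obtained from a list of states. -/
def nextStates (S : List WindowState) : List WindowState :=
  S.flatMap fun s =>
    (List.range (tribo4 [s.2.1]).length).flatMap fun r : ℕ =>
      ((List.range (tribo4 [s.2.2]).length).filter fun k : ℕ =>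
        (r : ℤ) + 13 ≤ coordSum (incidence4 s.1) + k ∧
          coordSum (incidence4 s.1) + k ≤ r + 15).map fun k => nextState s r k

/-- The states of the windows whose length exceeds `F 4 + F 8 + ⋯ + F (4 * i)` by at most two,
for all `i`. -/
def windowStates : List WindowState :=
  [((-1, 0, 1), 1, 0), ((-1, 0, 1), 2, 0), ((0, -1, 1), 0, 0), ((0, -1, 1), 0, 1),
    ((0, -1, 1), 2, 1), ((0, 0, 0), 0, 0), ((0, 0, 0), 0, 2), ((0, 0, 0), 1, 0),
    ((0, 0, 0), 1, 1), ((0, 0, 0), 1, 2), ((0, 0, 0), 2, 0), ((0, 0, 0), 2, 2), ((0, 0, 1), 0, 0),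
    ((0, 0, 1), 1, 0), ((0, 0, 1), 1, 1), ((0, 0, 1), 2, 0), ((0, 1, -1), 1, 0),
    ((0, 1, 0), 1, 0), ((0, 1, 1), 1, 0), ((1, -1, 0), 0, 1), ((1, -1, 1), 0, 1),
    ((1, 0, -1), 0, 1), ((1, 0, -1), 0, 2), ((1, 0, 0), 0, 0), ((1, 0, 0), 0, 1),
    ((1, 0, 0), 0, 2), ((1, 0, 0), 1, 1), ((1, 0, 0), 2, 1), ((1, 0, 0), 2, 2), ((1, 0, 1), 0, 0),
    ((1, 0, 1), 0, 1), ((1, 0, 1), 1, 1), ((1, 0, 1), 2, 0), ((1, 0, 1), 2, 1),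
    ((1, 1, -1), 0, 0), ((1, 1, -1), 1, 2), ((1, 1, 0), 0, 0), ((1, 1, 0), 1, 0),
    ((1, 1, 0), 1, 1), ((1, 1, 0), 1, 2), ((1, 1, 0), 2, 0), ((2, 0, 0), 0, 1), ((2, 0, 0), 0, 2),
    ((2, 1, -1), 0, 2)]

/-- Some of the states, ordered in such a way that the first `3 * i + 3` of them are attained
at level `i`. -/
def attainedStates : List WindowState :=
  [((0, 1, 0), 1, 0), ((0, 0, 0), 0, 0), ((1, 0, 0), 0, 1), ((1, -1, 1), 0, 1),
    ((0, -1, 1), 0, 0), ((1, -1, 0), 0, 1), ((0, 1, -1), 1, 0), ((1, 1, -1), 0, 0),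
    ((1, 0, -1), 0, 1), ((-1, 0, 1), 2, 0)]

theorem initialStates_subset : initialStates ⊆ windowStates := by
  decide +kernel

theorem nextStates_windowStates_subset : nextStates windowStates ⊆ windowStates := by
  decide +kernel

/-- Windows whose length lies outside the admissible range have no admissible successors. -/
theorem windowStates_separated : ∀ s ∈ windowStates,
    (coordSum s.1 = 2 → (2 : ℤ) + 13 + (tribo4 [s.2.1]).length
      ≤ coordSum (incidence4 s.1) + (tribo4 [s.2.2]).length) ∧
    (coordSum s.1 = 0 → coordSum (incidence4 s.1) < 14) := by
  decide +kernel

theorem mem_of_mem_windowStates : ∀ s ∈ windowStates, coordSum s.1 = 0 →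
    s.1 ∈ ([(0, 0, 0), (0, -1, 1), (1, -1, 0), (1, 0, -1), (0, 1, -1), (-1, 0, 1)] :
      List (ℤ × ℤ × ℤ)) := by
  decide +kernel

theorem exists_mem_attainedStates :
    ∀ v ∈ ([(0, 0, 0), (0, -1, 1), (1, -1, 0), (1, 0, -1), (0, 1, -1), (-1, 0, 1)] :
      List (ℤ × ℤ × ℤ)), ∃ s ∈ attainedStates, s.1 = v := by
  decide +kernel

theorem attainedStates_take_subset : ∀ i < 3,
    attainedStates.take (3 * (i + 1) + 3) ⊆ nextStates (attainedStates.take (3 * i + 3)) := by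
  decide +kernel

theorem attainedStates_subset_nextStates : attainedStates ⊆ nextStates attainedStates := by
  decide +kernel

/-- `t` is the Tribonacci word. -/
def IsTribonacciWord (t : ℕ → ℕ) : Prop :=
  (∀ i, t i < 3) ∧ ∀ k : ℕ, iterW tribo k [0] = pref t (iterW tribo k [0]).length

theorem iterW_append (φ : ℕ → List ℕ) (k : ℕ) (u v : List ℕ) :
    iterW φ k (u ++ v) = iterW φ k u ++ iterW φ k v := by
  induction k generalizing u v with
  | zero => rfl
  | succ k ih =>
    have h : substW φ (u ++ v) = substW φ u ++ substW φ v := by simp [substW]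
    simp only [iterW, Function.iterate_succ_apply, h] at ih ⊢
    exact ih _ _

theorem iterW_add (φ : ℕ → List ℕ) (k l : ℕ) (w : List ℕ) :
    iterW φ (k + l) w = iterW φ k (iterW φ l w) :=
  Function.iterate_add_apply _ _ _ _

theorem tribo4_append (u v : List ℕ) : tribo4 (u ++ v) = tribo4 u ++ tribo4 v :=
  iterW_append _ _ _ _

theorem length_le_length_iterW_tribo (k : ℕ) (w : List ℕ) :
    w.length ≤ (iterW tribo k w).length := by
  have h : ∀ w : List ℕ, w.length ≤ (substW tribo w).length := by
    intro w
    induction w with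
    | nil => simp
    | cons a w ih =>
      have ha : 1 ≤ (tribo a).length := by
        unfold tribo; split <;> simp
      simp only [substW, List.flatMap_cons, List.length_append, List.length_cons] at ih ⊢
      omega
  induction k generalizing w with
  | zero => exact le_rfl
  | succ k ih =>
    rw [iterW_add]
    exact (h w).trans (ih _)

theorem succ_le_triboF (k : ℕ) : k + 1 ≤ triboF k := by
  induction k with
  | zero => exact le_rfl
  | succ k ih =>
    have h : iterW tribo 1 [0] = [0] ++ [1] := rfl
    have h1 := length_le_length_iterW_tribo k [1]
    rw [triboF] at ih ⊢
    rw [iterW_add, h, iterW_append, List.length_append]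
    simp only [List.length_singleton] at h1
    omega

theorem length_pref (u : ℕ → ℕ) (n : ℕ) : (pref u n).length = n := by simp [pref]

theorem pref_succ (u : ℕ → ℕ) (n : ℕ) : pref u (n + 1) = pref u n ++ [u n] := by
  simp [pref, List.range_succ]

theorem pref_add (u : ℕ → ℕ) (m n : ℕ) :
    pref u (m + n) = pref u m ++ (List.range n).map fun j => u (m + j) := by
  simp [pref, List.range_add, Function.comp_def]

theorem pref_eq_of_append {u : ℕ → ℕ} {n : ℕ} {v w : List ℕ} (h : pref u n = v ++ w) :
    pref u v.length = v := by
  have hn : n = v.length + w.length := by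
    rw [← length_pref u n, h, List.length_append]
  rw [hn, pref_add] at h
  exact (List.append_inj h (length_pref _ _)).1

theorem letterCounts_append (u v : List ℕ) :
    letterCounts (u ++ v) = letterCounts u + letterCounts v := by
  simp [letterCounts]

theorem coordSum_add (v w : ℤ × ℤ × ℤ) : coordSum (v + w) = coordSum v + coordSum w := by
  simp only [coordSum, Prod.fst_add, Prod.snd_add]; ring

theorem coordSum_sub (v w : ℤ × ℤ × ℤ) : coordSum (v - w) = coordSum v - coordSum w := by
  simp only [coordSum, Prod.fst_sub, Prod.snd_sub]; ring

theorem incidence4_add (v w : ℤ × ℤ × ℤ) :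
    incidence4 (v + w) = incidence4 v + incidence4 w := by
  simp only [incidence4, Prod.fst_add, Prod.snd_add, Prod.mk_add_mk, Prod.mk.injEq]
  refine ⟨?_, ?_, ?_⟩ <;> ring

theorem incidence4_sub (v w : ℤ × ℤ × ℤ) :
    incidence4 (v - w) = incidence4 v - incidence4 w := by
  rw [eq_sub_iff_add_eq, ← incidence4_add, sub_add_cancel]

theorem coordSum_letterCounts {w : List ℕ} (hw : ∀ a ∈ w, a < 3) :
    coordSum (letterCounts w) = w.length := by
  induction w with
  | nil => rfl
  | cons a w ih =>
    have ha : a < 3 := hw a (by simp)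
    have h : coordSum (letterCounts [a]) = 1 := by interval_cases a <;> rfl
    rw [← List.singleton_append, letterCounts_append, coordSum_add, h,
      ih fun b hb => hw b (by simp [hb])]
    push_cast [List.length_append, List.length_singleton]
    rfl

theorem letterCounts_tribo4 {w : List ℕ} (hw : ∀ a ∈ w, a < 3) :
    letterCounts (tribo4 w) = incidence4 (letterCounts w) := by
  induction w with
  | nil => rfl
  | cons a w ih =>
    have ha : a < 3 := hw a (by simp)
    have h : letterCounts (tribo4 [a]) = incidence4 (letterCounts [a]) := by
      interval_cases a <;> rfl
    rw [← List.singleton_append, tribo4_append, letterCounts_append, letterCounts_append,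
      incidence4_add, h, ih fun b hb => hw b (by simp [hb])]

theorem length_tribo4 {w : List ℕ} (hw : ∀ a ∈ w, a < 3) :
    ((tribo4 w).length : ℤ) = coordSum (incidence4 (letterCounts w)) := by
  induction w with
  | nil => rfl
  | cons a w ih =>
    have ha : a < 3 := hw a (by simp)
    have h : ((tribo4 [a]).length : ℤ) = coordSum (incidence4 (letterCounts [a])) := by
      interval_cases a <;> rfl
    rw [← List.singleton_append, tribo4_append, letterCounts_append, List.length_append,
      incidence4_add, coordSum_add, Nat.cast_add, h, ih fun b hb => hw b (by simp [hb])]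

theorem exists_tribo4_singleton {a : ℕ} (ha : a < 3) : ∃ w, tribo4 [a] = [0, 1] ++ w := by
  interval_cases a <;> exact ⟨_, rfl⟩

theorem length_block (a : ℕ) : (block a).length = (tribo4 [a]).length + 2 := by
  simp [block]

/-- The Parikh vector of the prefix of length `n`. -/
def prefCounts (t : ℕ → ℕ) (n : ℕ) : ℤ × ℤ × ℤ := letterCounts (pref t n)

/-- The length of the image under `tribo4` of the prefix of length `n`. -/
def inflate (t : ℕ → ℕ) (n : ℕ) : ℕ := (tribo4 (pref t n)).length

/-- `s` is the state of a window whose length exceeds `n` by at most two. -/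
def IsState (t : ℕ → ℕ) (n : ℕ) (s : WindowState) : Prop :=
  ∃ q q', q + n ≤ q' ∧ q' ≤ q + n + 2 ∧
    s = (prefCounts t q' - prefCounts t q - prefCounts t n, t q, t q')

theorem inflate_succ (t : ℕ → ℕ) (n : ℕ) :
    inflate t (n + 1) = inflate t n + (tribo4 [t n]).length := by
  simp [inflate, pref_succ, tribo4_append]

theorem inflate_mono (t : ℕ → ℕ) : Monotone (inflate t) :=
  monotone_nat_of_le_succ fun n => by rw [inflate_succ]; omega

namespace IsTribonacciWord

variable {t : ℕ → ℕ}

theorem lt_three_of_mem_pref (h : IsTribonacciWord t) (n : ℕ) : ∀ a ∈ pref t n, a < 3 := by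
  intro a ha
  obtain ⟨j, -, rfl⟩ := List.mem_map.1 ha
  exact h.1 j

theorem coordSum_prefCounts (h : IsTribonacciWord t) (n : ℕ) :
    coordSum (prefCounts t n) = n := by
  rw [prefCounts, coordSum_letterCounts (h.lt_three_of_mem_pref n), length_pref]

theorem pref_inflate (h : IsTribonacciWord t) (n : ℕ) :
    pref t (inflate t n) = tribo4 (pref t n) := by
  obtain ⟨m, hm⟩ := Nat.exists_eq_add_of_le ((Nat.le_succ n).trans (succ_le_triboF n))
  have h1 := h.2 (4 + n)
  have h2 : iterW tribo n [0] = pref t (triboF n) := h.2 n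
  rw [iterW_add, h2, hm, pref_add, iterW_append] at h1
  exact pref_eq_of_append h1.symm

theorem prefCounts_inflate (h : IsTribonacciWord t) (n : ℕ) :
    prefCounts t (inflate t n) = incidence4 (prefCounts t n) := by
  rw [prefCounts, h.pref_inflate, letterCounts_tribo4 (h.lt_three_of_mem_pref n), prefCounts]

theorem inflate_eq (h : IsTribonacciWord t) (n : ℕ) :
    (inflate t n : ℤ) = coordSum (incidence4 (prefCounts t n)) :=
  length_tribo4 (h.lt_three_of_mem_pref n)

theorem pref_inflate_add (h : IsTribonacciWord t) (q : ℕ) {r : ℕ}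
    (hr : r ≤ (block (t q)).length) :
    pref t (inflate t q + r) = pref t (inflate t q) ++ (block (t q)).take r := by
  obtain ⟨w, hw⟩ := exists_tribo4_singleton (h.1 (q + 1))
  have h1 : pref t (inflate t (q + 2)) =
      (pref t (inflate t q) ++ (block (t q)).take r) ++ ((block (t q)).drop r ++ w) := by
    rw [h.pref_inflate, h.pref_inflate, pref_succ, pref_succ, tribo4_append, tribo4_append, hw,
      List.append_assoc, List.append_assoc, ← List.append_assoc (List.take _ _),
      List.take_append_drop, block, List.append_assoc]
  have h2 := pref_eq_of_append h1
  rwa [List.length_append, length_pref, List.length_take, min_eq_left hr] at h2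

theorem prefCounts_inflate_add (h : IsTribonacciWord t) (q : ℕ) {r : ℕ}
    (hr : r ≤ (block (t q)).length) :
    prefCounts t (inflate t q + r) =
      incidence4 (prefCounts t q) + letterCounts ((block (t q)).take r) := by
  rw [← h.prefCounts_inflate, prefCounts, prefCounts, h.pref_inflate_add q hr,
    letterCounts_append]

theorem apply_inflate_add (h : IsTribonacciWord t) (q : ℕ) {r : ℕ}
    (hr : r < (block (t q)).length) :
    t (inflate t q + r) = (block (t q)).getD r 0 := by
  have h1 := h.pref_inflate_add q (r := r + 1) hr
  rw [← add_assoc, pref_succ, h.pref_inflate_add q hr.le, ← List.take_append_getElem hr,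
    ← List.append_assoc] at h1
  rw [List.getD_eq_getElem _ _ hr]
  simpa using List.append_cancel_left h1

theorem length_tribo4_pos (h : IsTribonacciWord t) (q : ℕ) : 0 < (tribo4 [t q]).length := by
  obtain ⟨w, hw⟩ := exists_tribo4_singleton (h.1 q)
  simp [hw]

theorem exists_eq_inflate_add (h : IsTribonacciWord t) (p : ℕ) :
    ∃ q r, r < (tribo4 [t q]).length ∧ p = inflate t q + r := by
  induction p with
  | zero => exact ⟨0, 0, h.length_tribo4_pos 0, rfl⟩
  | succ p ih =>
    obtain ⟨q, r, hr, rfl⟩ := ih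
    by_cases hr' : r + 1 < (tribo4 [t q]).length
    · exact ⟨q, r + 1, hr', rfl⟩
    · refine ⟨q + 1, 0, h.length_tribo4_pos _, ?_⟩
      rw [inflate_succ]
      omega

theorem nextState_eq (h : IsTribonacciWord t) {n n' q q' r r' : ℕ}
    (hn : prefCounts t n' = incidence4 (prefCounts t n + (1, 0, 0)))
    (hr : r < (tribo4 [t q]).length) (hr' : r' < (tribo4 [t q']).length) :
    nextState (prefCounts t q' - prefCounts t q - prefCounts t n, t q, t q') r r' =
      (prefCounts t (inflate t q' + r') - prefCounts t (inflate t q + r) - prefCounts t n',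
        t (inflate t q + r), t (inflate t q' + r')) := by
  have hb := length_block (t q)
  have hb' := length_block (t q')
  rw [h.apply_inflate_add q (by omega), h.apply_inflate_add q' (by omega),
    h.prefCounts_inflate_add q (by omega), h.prefCounts_inflate_add q' (by omega), hn]
  simp only [nextState, incidence4_sub, incidence4_add, Prod.mk.injEq, and_true]
  abel

/-- The coordinate sum of the image of a discrepancy vector, in terms of positions. -/
theorem coordSum_incidence4 (h : IsTribonacciWord t) (q q' n : ℕ) :
    coordSum (incidence4 (prefCounts t q' - prefCounts t q - prefCounts t n)) =
      inflate t q' - inflate t q - inflate t n := by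
  simp only [incidence4_sub, coordSum_sub, h.inflate_eq]

theorem length_eq_inflate_add (h : IsTribonacciWord t) {n n' : ℕ}
    (hn : prefCounts t n' = incidence4 (prefCounts t n + (1, 0, 0))) :
    (n' : ℤ) = inflate t n + 13 := by
  rw [← h.coordSum_prefCounts, hn, incidence4_add, coordSum_add, h.inflate_eq]
  rfl

theorem mem_nextStates_iff {S : List WindowState} {x : WindowState} :
    x ∈ nextStates S ↔ ∃ s ∈ S, ∃ r < (tribo4 [s.2.1]).length, ∃ r' < (tribo4 [s.2.2]).length,
      (r + 13 ≤ coordSum (incidence4 s.1) + r' ∧ coordSum (incidence4 s.1) + r' ≤ r + 15) ∧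
        nextState s r r' = x := by
  simp only [nextStates, List.mem_flatMap, List.mem_map, List.mem_filter, List.mem_range,
    decide_eq_true_eq, and_assoc]

theorem isState_of_mem_nextStates (h : IsTribonacciWord t) {n n' : ℕ}
    (hn : prefCounts t n' = incidence4 (prefCounts t n + (1, 0, 0))) {S : List WindowState}
    (hS : ∀ s ∈ S, IsState t n s) : ∀ s ∈ nextStates S, IsState t n' s := by
  intro x hx
  obtain ⟨s, hs, r, hr, r', hr', ⟨h1, h2⟩, rfl⟩ := mem_nextStates_iff.1 hx
  obtain ⟨q, q', -, -, rfl⟩ := hS s hs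
  rw [h.coordSum_incidence4] at h1 h2
  have h3 := h.length_eq_inflate_add hn
  exact ⟨inflate t q + r, inflate t q' + r', by omega, by omega, h.nextState_eq hn hr hr'⟩

theorem mem_windowStates_of_isState (h : IsTribonacciWord t) {n n' : ℕ}
    (hn : prefCounts t n' = incidence4 (prefCounts t n + (1, 0, 0)))
    (hS : ∀ s, IsState t n s → s ∈ windowStates) : ∀ s, IsState t n' s → s ∈ windowStates := by
  rintro _ ⟨p, p', h1, h2, rfl⟩
  obtain ⟨q, r, hr, rfl⟩ := h.exists_eq_inflate_add p
  obtain ⟨q', r', hr', rfl⟩ := h.exists_eq_inflate_add p'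
  have h3 := h.length_eq_inflate_add hn
  have hsum (q q' : ℕ) : coordSum (prefCounts t q' - prefCounts t q - prefCounts t n) =
      q' - q - n := by
    simp only [coordSum_sub, h.coordSum_prefCounts]
  have hlow : q + n ≤ q' := by
    by_contra! hlt
    have h4 := (windowStates_separated _ (hS _ ⟨q, q + n, le_rfl, by omega, rfl⟩)).2
      (by rw [hsum]; omega)
    rw [h.coordSum_incidence4] at h4
    have h5 := inflate_mono t hlt
    rw [Nat.succ_eq_add_one, inflate_succ] at h5
    omega
  have hupp : q' ≤ q + n + 2 := by
    by_contra! hlt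
    have h4 := (windowStates_separated _ (hS _ ⟨q, q + n + 2, by omega, le_rfl, rfl⟩)).1
      (by rw [hsum]; omega)
    rw [h.coordSum_incidence4] at h4
    dsimp only at h4
    have h5 := inflate_mono t hlt
    rw [Nat.succ_eq_add_one, inflate_succ] at h5
    omega
  refine nextStates_windowStates_subset (mem_nextStates_iff.2
    ⟨_, hS _ ⟨q, q', hlow, hupp, rfl⟩, r, hr, r', hr', ?_, h.nextState_eq hn hr hr'⟩)
  rw [h.coordSum_incidence4]
  omega

theorem mem_windowStates_of_isState_zero (h : IsTribonacciWord t) (s : WindowState)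
    (hs : IsState t 0 s) : s ∈ windowStates := by
  obtain ⟨p, p', h1, h2, rfl⟩ := hs
  obtain ⟨q, r, hr, rfl⟩ := h.exists_eq_inflate_add p
  obtain ⟨j, rfl⟩ := Nat.exists_eq_add_of_le h1
  have hb := length_block (t q)
  have h0 : prefCounts t 0 = 0 := rfl
  rw [add_zero, add_assoc, h.apply_inflate_add q (by omega), h.apply_inflate_add q (by omega),
    h.prefCounts_inflate_add q (by omega), h.prefCounts_inflate_add q (by omega), h0, sub_zero,
    add_sub_add_left_eq_sub]
  have ht := h.1 q
  refine initialStates_subset (List.mem_flatMap.2 ⟨t q, ?_, List.mem_flatMap.2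
    ⟨r, List.mem_range.2 hr, List.mem_map.2 ⟨j, ?_, rfl⟩⟩⟩)
  · interval_cases t q <;> simp
  · have hj : j < 3 := by omega
    interval_cases j <;> simp

theorem isState_zero_of_mem (h : IsTribonacciWord t) :
    ∀ s ∈ attainedStates.take 3, IsState t 0 s := by
  have h2 : [0, 1, 0, 2] = pref t 4 := h.2 2
  have h3 : t 0 = 0 ∧ t 1 = 1 ∧ t 2 = 0 := by
    simp [pref, List.range_succ] at h2
    omega
  obtain ⟨h0, h1, h2⟩ := h3
  simp only [attainedStates, List.take_succ_cons, List.take_zero, List.mem_cons,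
    List.not_mem_nil, or_false]
  rintro s (rfl | rfl | rfl)
  · exact ⟨1, 2, by simp, by simp, by simp [prefCounts, pref, letterCounts, List.range_succ, *]⟩
  · exact ⟨0, 0, by simp, by simp, by simp [prefCounts, pref, letterCounts, *]⟩
  · exact ⟨0, 1, by simp, by simp, by simp [prefCounts, pref, letterCounts, *]⟩

end IsTribonacciWord

/-- The prefix of the Tribonacci word of length `F 4 + F 8 + ⋯ + F (4 * i)`. -/
def levelWord : ℕ → List ℕ
  | 0 => []
  | i + 1 => tribo4 (levelWord i ++ [0])

theorem length_levelWord (i : ℕ) :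
    (levelWord i).length = ∑ j ∈ Finset.Icc 1 i, triboF (4 * j) := by
  have key (i k : ℕ) : (iterW tribo (4 * k) (levelWord i)).length =
      ∑ j ∈ Finset.range i, triboF (4 * (j + 1 + k)) := by
    induction i generalizing k with
    | zero =>
      have h := iterW_append tribo (4 * k) [] []
      simpa [levelWord] using h
    | succ i ih =>
      rw [levelWord, tribo4, ← iterW_add, iterW_append, List.length_append,
        Finset.sum_range_succ', ← triboF, ← mul_add_one, ih]
      congr 1
      · exact Finset.sum_congr rfl fun j _ => by congr 2; ring
      · congr 2; ring
  have h := key i 0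
  rw [Finset.range_eq_Ico, Finset.sum_Ico_add' (fun j => triboF (4 * (j + 0)))] at h
  rw [zero_add] at h
  exact h

namespace IsTribonacciWord

variable {t : ℕ → ℕ}

theorem pref_length_levelWord_succ (h : IsTribonacciWord t) (i : ℕ) :
    pref t ((levelWord i).length + 1) = levelWord i ++ [0] := by
  induction i with
  | zero =>
    have h0 : [0] = pref t 1 := h.2 0
    exact h0.symm
  | succ i ih =>
    have h1 := h.pref_inflate ((levelWord i).length + 1 + 1)
    obtain ⟨w, hw⟩ := exists_tribo4_singleton (h.1 ((levelWord i).length + 1))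
    rw [pref_succ, ih, tribo4_append, hw] at h1
    have h2 : pref t (inflate t ((levelWord i).length + 1 + 1)) =
        (levelWord (i + 1) ++ [0]) ++ (1 :: w) := by
      rw [h1]; simp [levelWord]
    simpa using pref_eq_of_append h2

theorem prefCounts_length_levelWord_succ (h : IsTribonacciWord t) (i : ℕ) :
    prefCounts t (levelWord (i + 1)).length =
      incidence4 (prefCounts t (levelWord i).length + (1, 0, 0)) := by
  have h1 := h.pref_length_levelWord_succ i
  have h2 : inflate t ((levelWord i).length + 1) = (levelWord (i + 1)).length := by
    rw [inflate, h1, levelWord]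
  rw [← h2, h.prefCounts_inflate, prefCounts, h1, letterCounts_append, prefCounts,
    pref_eq_of_append h1]
  rfl

theorem isState_levelWord_mem (h : IsTribonacciWord t) (i : ℕ) :
    ∀ s, IsState t (levelWord i).length s → s ∈ windowStates := by
  induction i with
  | zero => exact h.mem_windowStates_of_isState_zero
  | succ i ih => exact h.mem_windowStates_of_isState (h.prefCounts_length_levelWord_succ i) ih

theorem isState_levelWord_of_mem (h : IsTribonacciWord t) {i : ℕ} (hi : 3 ≤ i) :
    ∀ s ∈ attainedStates, IsState t (levelWord i).length s := by
  have h3 : ∀ i < 4, ∀ s ∈ attainedStates.take (3 * i + 3),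
      IsState t (levelWord i).length s := by
    intro i hi
    induction i with
    | zero => exact h.isState_zero_of_mem
    | succ i ih =>
      exact fun s hs => h.isState_of_mem_nextStates (h.prefCounts_length_levelWord_succ i)
        (ih (by omega)) s (attainedStates_take_subset i (by omega) hs)
  induction i, hi using Nat.le_induction with
  | base => exact h3 3 (by omega)
  | succ i hi ih =>
    exact fun s hs => h.isState_of_mem_nextStates (h.prefCounts_length_levelWord_succ i) ih s
      (attainedStates_subset_nextStates hs)

theorem mem_relParikhSet_iff {n : ℕ} {v : Fin 3 → ℤ} :
    v ∈ relParikhSet 3 t n ↔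
      ∃ q, (v 0, v 1, v 2) = prefCounts t (q + n) - prefCounts t q - prefCounts t n := by
  have key (q : ℕ) : v = parikh 3 ((List.range n).map fun j => t (q + j)) - parikh 3 (pref t n) ↔
      (v 0, v 1, v 2) = prefCounts t (q + n) - prefCounts t q - prefCounts t n := by
    rw [prefCounts, pref_add, letterCounts_append, ← prefCounts, add_sub_cancel_left]
    simp [funext_iff, Fin.forall_fin_succ, parikh, prefCounts, letterCounts]
  constructor
  · rintro ⟨w, ⟨q, hw⟩, rfl, hv⟩
    rw [hw] at hv
    simp only [List.length_map, List.length_range] at hv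
    exact ⟨q, (key q).1 hv⟩
  · rintro ⟨q, hq⟩
    exact ⟨_, ⟨q, by simp⟩, by simp, (key q).2 hq⟩

theorem relParikhSet_eq (h : IsTribonacciWord t) {i : ℕ} (hi : 3 ≤ i) :
    relParikhSet 3 t (levelWord i).length =
      ({![0, 0, 0], ![0, -1, 1], ![1, -1, 0], ![1, 0, -1], ![0, 1, -1],
        ![-1, 0, 1]} : Set (Fin 3 → ℤ)) := by
  ext v
  have hv : v ∈ ({![0, 0, 0], ![0, -1, 1], ![1, -1, 0], ![1, 0, -1], ![0, 1, -1],
      ![-1, 0, 1]} : Set (Fin 3 → ℤ)) ↔ (v 0, v 1, v 2) ∈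
      ([(0, 0, 0), (0, -1, 1), (1, -1, 0), (1, 0, -1), (0, 1, -1), (-1, 0, 1)] :
        List (ℤ × ℤ × ℤ)) := by
    simp [funext_iff, Fin.forall_fin_succ]
  rw [mem_relParikhSet_iff, hv]
  constructor
  · rintro ⟨q, hq⟩
    rw [hq]
    refine mem_of_mem_windowStates _
      (h.isState_levelWord_mem i _ ⟨q, q + (levelWord i).length, le_rfl, by omega, rfl⟩) ?_
    simp only [coordSum_sub, h.coordSum_prefCounts]
    push_cast
    ring
  · intro hm
    obtain ⟨s, hs, hsv⟩ := exists_mem_attainedStates _ hm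
    obtain ⟨q, q', -, -, rfl⟩ := h.isState_levelWord_of_mem hi s hs
    have hsum : coordSum (v 0, v 1, v 2) = 0 := by
      generalize (v 0, v 1, v 2) = x at hm
      revert x
      decide
    rw [← hsv] at hsum ⊢
    simp only [coordSum_sub, h.coordSum_prefCounts] at hsum
    have hq : q' = q + (levelWord i).length := by omega
    exact ⟨q, by rw [hq]⟩

end IsTribonacciWord

theorem stmt17 (t : ℕ → ℕ) (ht : ∀ i, t i < 3)
    (htfix : ∀ k : ℕ, iterW tribo k [0] = pref t (iterW tribo k [0]).length)
    (M : ℕ → ℕ) (hM : ∀ i, M i = ∑ j ∈ Finset.Icc 1 i, triboF (4 * j)) :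
    (∀ i : ℕ, 3 ≤ i →
      relParikhSet 3 t (M i) =
        ({![0, 0, 0], ![0, -1, 1], ![1, -1, 0], ![1, 0, -1], ![0, 1, -1],
          ![-1, 0, 1]} : Set (Fin 3 → ℤ)) ∧
      (relParikhSet 3 t (M i)).ncard = 6) ∧
    { n : ℕ | (relParikhSet 3 t n).ncard = 6 }.Infinite := by
  have h : IsTribonacciWord t := ⟨ht, htfix⟩
  have hlen (i : ℕ) : M i = (levelWord i).length := by rw [hM, length_levelWord]
  have hset (i : ℕ) (hi : 3 ≤ i) : relParikhSet 3 t (M i) =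
      ({![0, 0, 0], ![0, -1, 1], ![1, -1, 0], ![1, 0, -1], ![0, 1, -1],
        ![-1, 0, 1]} : Set (Fin 3 → ℤ)) := by
    rw [hlen, h.relParikhSet_eq hi]
  have hcard (i : ℕ) (hi : 3 ≤ i) : (relParikhSet 3 t (M i)).ncard = 6 := by
    rw [hset i hi, Set.ncard_eq_toFinset_card']
    decide
  have hmono : StrictMono fun i => M (i + 3) := strictMono_nat_of_lt_succ fun i => by
    have hpos := succ_le_triboF (4 * (i + 3 + 1))
    rw [hM, hM, show i + 1 + 3 = i + 3 + 1 by ring, Finset.sum_Icc_succ_top (show 1 ≤ i + 3 + 1 by omega)]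
    omega
  exact ⟨fun i hi => ⟨hset i hi, hcard i hi⟩,
    Set.infinite_of_injective_forall_mem hmono.injective fun i => hcard (i + 3) (by omega)⟩
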